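/- arXiv:2310.03939 — 2 statements merged into one kernel-verified Lean document; each statement's English description precedes it below -/
import Mathlib

section
/- Fix r > 0 and ε ∈ (−1,0). On the open simplex Δ = {(z₁,z₂,z₃) ∈ (0,∞)³ : z₁+z₂+z₃ < 1}, with z₄ := 1−z₁−z₂−z₃ and F := r·z₁z₃ + z₂z₄ > 0, the functions z₁z₂z₃z₄·F^{−(4+ε)}, z₁z₃·F^{−(3+ε)} and z₁z₂z₃·F^{−(3+ε)} are Lebesgue integrable on Δ, and (3+ε)·∫_Δ z₁z₂z₃z₄ F^{−(4+ε)} = ∫_Δ z₁z₃ F^{−(3+ε)} + 2ε·∫_Δ z₁z₂z₃ F^{−(3+ε)}. -/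
open MeasureTheory

noncomputable section

/-- The open simplex `Δ = {(z₁,z₂,z₃) ∈ (0,∞)³ : z₁+z₂+z₃ < 1}`. -/
def boxDelta : Set (ℝ × ℝ × ℝ) :=
  {z | 0 < z.1 ∧ 0 < z.2.1 ∧ 0 < z.2.2 ∧ z.1 + z.2.1 + z.2.2 < 1}

/-- The fourth Feynman parameter `z₄ = 1 − z₁ − z₂ − z₃`. -/
def boxZ4 (z : ℝ × ℝ × ℝ) : ℝ := 1 - z.1 - z.2.1 - z.2.2

/-- The second Symanzik polynomial of the massless box, `F = r z₁ z₃ + z₂ z₄`. -/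
def boxF (r : ℝ) (z : ℝ × ℝ × ℝ) : ℝ := r * z.1 * z.2.2 + z.2.1 * boxZ4 z

end

open scoped ENNReal

section Beta

open ProbabilityTheory

/-- Scaled Euler beta integral, in `ℝ≥0∞`-valued form. -/
lemma lintegral_rpow_mul_sub_rpow {α β c : ℝ} (hα : 0 < α) (hβ : 0 < β) (hc : 0 < c) :
    ∫⁻ x in Set.Ioo 0 c, ENNReal.ofReal (x ^ (α - 1) * (c - x) ^ (β - 1)) =
      ENNReal.ofReal (beta α β) * ENNReal.ofReal (c ^ (α + β - 1)) := by
  have hb := beta_pos hα hβ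
  have hscale : ∀ x, (Set.Ioo 0 c).indicator
      (fun x => ENNReal.ofReal (x ^ (α - 1) * (c - x) ^ (β - 1))) (c * x) =
      ENNReal.ofReal (c ^ (α + β - 2) * beta α β) * betaPDF α β x := by
    intro x
    by_cases hx : 0 < x ∧ x < 1
    · have hcx : c * x ∈ Set.Ioo 0 c := ⟨by nlinarith [hx.1], by nlinarith [hx.2]⟩
      rw [Set.indicator_of_mem hcx, betaPDF_of_pos_lt_one hx.1 hx.2,
        ← ENNReal.ofReal_mul (by positivity)]
      congr 1
      have h1 : c - c * x = c * (1 - x) := by ring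
      have h2 : c ^ (α + β - 2) = c ^ (α - 1) * c ^ (β - 1) := by
        rw [← Real.rpow_add hc]; ring_nf
      rw [h1, Real.mul_rpow hc.le hx.1.le, Real.mul_rpow hc.le (by linarith [hx.2]), h2]
      field_simp
    · have hcx : c * x ∉ Set.Ioo 0 c := fun h =>
        hx ⟨pos_of_mul_pos_right h.1 hc.le, by nlinarith [h.2]⟩
      rw [Set.indicator_of_notMem hcx, betaPDF_eq, if_neg hx]
      simp
  rw [← lintegral_indicator measurableSet_Ioo, ← Real.smul_map_volume_mul_left hc.ne',
    lintegral_smul_measure, lintegral_map (Measurable.indicator (by fun_prop) measurableSet_Ioo)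
      (by fun_prop), lintegral_congr hscale, lintegral_const_mul' _ _ ENNReal.ofReal_ne_top,
    lintegral_betaPDF_eq_one hα hβ, mul_one, smul_eq_mul, abs_of_pos hc,
    ← ENNReal.ofReal_mul hc.le, ← ENNReal.ofReal_mul hb.le]
  congr 1
  have h : c ^ (α + β - 1) = c ^ (α + β - 2) * c := by
    rw [← Real.rpow_add_one hc.ne']; ring_nf
  rw [h]
  ring

end Beta

lemma measurableSet_boxDelta : MeasurableSet boxDelta := by
  simp only [boxDelta, Set.ofPred_and]
  refine .inter ?_ (.inter ?_ (.inter ?_ ?_)) <;>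
    exact measurableSet_lt (by fun_prop) (by fun_prop)

@[fun_prop]
lemma measurable_boxZ4 : Measurable boxZ4 := by
  unfold boxZ4
  fun_prop

@[fun_prop]
lemma measurable_boxF (r : ℝ) : Measurable (boxF r) := by
  unfold boxF
  fun_prop

lemma lintegral_boxDelta (f : ℝ × ℝ × ℝ → ℝ≥0∞) (hf : Measurable f) :
    ∫⁻ z in boxDelta, f z = ∫⁻ x in Set.Ioo (0 : ℝ) 1, ∫⁻ y in Set.Ioo 0 (1 - x),
      ∫⁻ w in Set.Ioo 0 (1 - x - y), f (x, y, w) := by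
  have hind : Measurable (boxDelta.indicator f) := hf.indicator measurableSet_boxDelta
  rw [← lintegral_indicator measurableSet_boxDelta, Measure.volume_eq_prod,
    lintegral_prod _ hind.aemeasurable, ← lintegral_indicator measurableSet_Ioo]
  refine lintegral_congr fun x => ?_
  rw [Measure.volume_eq_prod, lintegral_prod _ (by fun_prop)]
  by_cases hx : x ∈ Set.Ioo (0 : ℝ) 1
  · rw [Set.indicator_of_mem hx, ← lintegral_indicator measurableSet_Ioo]
    refine lintegral_congr fun y => ?_
    by_cases hy : y ∈ Set.Ioo 0 (1 - x)
    · rw [Set.indicator_of_mem hy, ← lintegral_indicator measurableSet_Ioo]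
      refine lintegral_congr fun w => ?_
      by_cases hw : w ∈ Set.Ioo 0 (1 - x - y)
      · rw [Set.indicator_of_mem hw, Set.indicator_of_mem]
        exact ⟨hx.1, hy.1, hw.1, by linarith [hw.2]⟩
      · rw [Set.indicator_of_notMem hw, Set.indicator_of_notMem]
        exact fun h => hw ⟨h.2.2.1, by linarith [h.2.2.2]⟩
    · rw [Set.indicator_of_notMem hy]
      refine (lintegral_congr fun w => ?_).trans lintegral_zero
      exact Set.indicator_of_notMem
        (fun h => hy ⟨h.2.1, by linarith [h.2.2.2, h.2.2.1]⟩) _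
  · rw [Set.indicator_of_notMem hx]
    refine (lintegral_congr fun y => (lintegral_congr fun w => ?_).trans lintegral_zero).trans
      lintegral_zero
    exact Set.indicator_of_notMem
      (fun h => hx ⟨h.1, by linarith [h.2.2.2, h.2.2.1, h.2.1]⟩) _

/-- The Dirichlet density is integrable on the simplex. -/
lemma integrableOn_dirichlet {a b c d : ℝ} (ha : 0 < a) (hb : 0 < b) (hc : 0 < c) (hd : 0 < d) :
    IntegrableOn (fun z => z.1 ^ (a - 1) * (z.2.1 ^ (b - 1) *
      (z.2.2 ^ (c - 1) * boxZ4 z ^ (d - 1)))) boxDelta volume := by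
  refine ⟨Measurable.aestronglyMeasurable (by fun_prop), ?_⟩
  rw [hasFiniteIntegral_iff_ofReal]
  · rw [lintegral_boxDelta _ (by fun_prop)]
    have hw : ∀ x ∈ Set.Ioo (0 : ℝ) 1, ∀ y ∈ Set.Ioo 0 (1 - x),
        ∫⁻ w in Set.Ioo 0 (1 - x - y), ENNReal.ofReal (x ^ (a - 1) * (y ^ (b - 1) *
          (w ^ (c - 1) * boxZ4 (x, y, w) ^ (d - 1)))) =
        ENNReal.ofReal (x ^ (a - 1)) * ENNReal.ofReal (ProbabilityTheory.beta c d) *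
          ENNReal.ofReal (y ^ (b - 1) * (1 - x - y) ^ (c + d - 1)) := by
      intro x hx y hy
      have hx0 := Real.rpow_nonneg hx.1.le (a - 1)
      have hy0 := Real.rpow_nonneg hy.1.le (b - 1)
      simp_rw [ENNReal.ofReal_mul hx0, ENNReal.ofReal_mul hy0]
      rw [lintegral_const_mul' _ _ ENNReal.ofReal_ne_top,
        lintegral_const_mul' _ _ ENNReal.ofReal_ne_top]
      have := lintegral_rpow_mul_sub_rpow hc hd (c := 1 - x - y) (by linarith [hy.2])
      simp only [boxZ4]
      rw [this]
      ring
    have hy : ∀ x ∈ Set.Ioo (0 : ℝ) 1, ∫⁻ y in Set.Ioo 0 (1 - x),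
        ∫⁻ w in Set.Ioo 0 (1 - x - y), ENNReal.ofReal (x ^ (a - 1) * (y ^ (b - 1) *
          (w ^ (c - 1) * boxZ4 (x, y, w) ^ (d - 1)))) =
        ENNReal.ofReal (ProbabilityTheory.beta c d) *
          ENNReal.ofReal (ProbabilityTheory.beta b (c + d)) *
          ENNReal.ofReal (x ^ (a - 1) * (1 - x) ^ (b + (c + d) - 1)) := by
      intro x hx
      rw [setLIntegral_congr_fun measurableSet_Ioo (hw x hx),
        lintegral_const_mul' _ _ (ENNReal.mul_ne_top ENNReal.ofReal_ne_top ENNReal.ofReal_ne_top),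
        lintegral_rpow_mul_sub_rpow hb (by linarith) (by linarith [hx.2]),
        ENNReal.ofReal_mul (Real.rpow_nonneg hx.1.le _)]
      ring
    rw [setLIntegral_congr_fun measurableSet_Ioo hy,
        lintegral_const_mul' _ _ (ENNReal.mul_ne_top ENNReal.ofReal_ne_top ENNReal.ofReal_ne_top),
        lintegral_rpow_mul_sub_rpow ha (by linarith) one_pos]
    exact ENNReal.mul_lt_top (ENNReal.mul_lt_top ENNReal.ofReal_lt_top ENNReal.ofReal_lt_top)
      (ENNReal.mul_lt_top ENNReal.ofReal_lt_top ENNReal.ofReal_lt_top)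
  · refine ae_restrict_of_forall_mem measurableSet_boxDelta fun z hz => ?_
    obtain ⟨h1, h2, h3, h4⟩ := hz
    have h5 : 0 < boxZ4 z := by unfold boxZ4; linarith
    simp only [Pi.zero_apply]
    positivity

/-- Integration over space by scaling each slice `z₂ = t` by `1 - t`. -/
lemma integral_cone_coordinates (H : ℝ × ℝ × ℝ → ℝ) (hm : Measurable H) (hi : Integrable H)
    (h0 : ∀ z, z.2.1 ∉ Set.Ioo (0 : ℝ) 1 → H z = 0) :
    ∫ z, H z = ∫ x : ℝ × ℝ, ∫ t in Set.Ioo (0 : ℝ) 1,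
      (1 - t) ^ 2 * H ((1 - t) * x.1, t, (1 - t) * x.2) := by
  let e : ℝ × ℝ × ℝ ≃ᵐ ℝ × ℝ × ℝ := MeasurableEquiv.prodAssoc.symm.trans
    ((MeasurableEquiv.prodCongr MeasurableEquiv.prodComm (MeasurableEquiv.refl ℝ)).trans
      MeasurableEquiv.prodAssoc)
  have he : MeasurePreserving e volume volume :=
    (volume_preserving_prodAssoc).comp
      (((Measure.measurePreserving_swap (μ := (volume : Measure ℝ)) (ν := (volume : Measure ℝ))).prod
        (MeasurePreserving.id volume)).comp volume_preserving_prodAssoc.symm)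
  have hei : Integrable (fun p => H (e p)) (volume : Measure (ℝ × ℝ × ℝ)) :=
    he.integrable_comp_of_integrable hi
  have hem : Measurable (fun p => H (e p)) := hm.comp e.measurable
  let K : ℝ × ℝ × ℝ → ℝ := fun p => (Set.Ioo (0 : ℝ) 1).indicator
    (fun t => (1 - t) ^ 2 * H ((1 - t) * p.2.1, t, (1 - t) * p.2.2)) p.1
  have hK1 : ∀ t ∈ Set.Ioo (0 : ℝ) 1, ∀ x : ℝ × ℝ,
      K (t, x) = (1 - t) ^ 2 * H (e (t, (1 - t) • x)) := fun t ht x =>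
    Set.indicator_of_mem ht _
  have hK0 : ∀ t ∉ Set.Ioo (0 : ℝ) 1, ∀ x : ℝ × ℝ, K (t, x) = 0 := fun t ht x =>
    Set.indicator_of_notMem ht _
  have hH0 : ∀ t ∉ Set.Ioo (0 : ℝ) 1, ∀ x : ℝ × ℝ, H (e (t, x)) = 0 := fun t ht x =>
    h0 _ ht
  have hKm : Measurable K := by
    have : K = Set.indicator (Prod.fst ⁻¹' Set.Ioo (0 : ℝ) 1)
      (fun p => (1 - p.1) ^ 2 * H ((1 - p.1) * p.2.1, p.1, (1 - p.1) * p.2.2)) := rfl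
    rw [this]
    exact Measurable.indicator (by fun_prop) (measurable_fst measurableSet_Ioo)
  have hscale : ∀ (t : ℝ), t ∈ Set.Ioo (0 : ℝ) 1 → ∀ g : ℝ × ℝ → ℝ,
      ∫ x, (1 - t) ^ 2 * g ((1 - t) • x) = ∫ x, g x := by
    intro t ht g
    have h1 : 0 < 1 - t := by linarith [ht.2]
    rw [integral_const_mul, Measure.integral_comp_smul]
    simp only [Module.finrank_prod, Module.finrank_self, smul_eq_mul]
    rw [abs_of_pos (by positivity)]
    field_simp
  have hslice : ∀ t, ∫ x, K (t, x) = ∫ x, H (e (t, x)) := by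
    intro t
    by_cases ht : t ∈ Set.Ioo (0 : ℝ) 1
    · simp_rw [hK1 t ht]
      exact hscale t ht fun x => H (e (t, x))
    · simp_rw [hK0 t ht, hH0 t ht]
  have hslice' : ∀ t, ∫ x, ‖K (t, x)‖ = ∫ x, ‖H (e (t, x))‖ := by
    intro t
    by_cases ht : t ∈ Set.Ioo (0 : ℝ) 1
    · simp_rw [hK1 t ht, norm_mul, Real.norm_of_nonneg (sq_nonneg (1 - t))]
      exact hscale t ht fun x => ‖H (e (t, x))‖
    · simp_rw [hK0 t ht, hH0 t ht]
  rw [Measure.volume_eq_prod] at hei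
  have hKi : Integrable K ((volume : Measure ℝ).prod (volume : Measure (ℝ × ℝ))) := by
    have hei' := (integrable_prod_iff hem.aestronglyMeasurable).1 hei
    refine (integrable_prod_iff hKm.aestronglyMeasurable).2 ⟨?_, ?_⟩
    · filter_upwards [hei'.1] with t hti
      by_cases ht : t ∈ Set.Ioo (0 : ℝ) 1
      · simp_rw [hK1 t ht]
        exact (hti.comp_smul (by linarith [ht.2] : 1 - t ≠ 0)).const_mul _
      · simp_rw [hK0 t ht]
        exact integrable_zero _ _ _
    · simp_rw [hslice']
      exact hei'.2
  calc ∫ z, H z = ∫ p, H (e p) := (he.integral_comp' H).symm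
    _ = ∫ t, ∫ x, H (e (t, x)) := by rw [Measure.volume_eq_prod, integral_prod _ hei]
    _ = ∫ t, ∫ x, K (t, x) := by simp_rw [hslice]
    _ = ∫ x, ∫ t, K (t, x) := by rw [← integral_prod _ hKi, integral_prod_symm _ hKi]
    _ = _ := by
      refine integral_congr_ae (Filter.Eventually.of_forall fun x => ?_)
      exact integral_indicator measurableSet_Ioo

open Filter Topology in
/-- The total derivative along a ray emanating from the vertex `z₂ = 1` integrates to zero. -/
lemma integral_ray_eq_zero {r ε p q s : ℝ} (hr : 0 < r) (hε : ε ∈ Set.Ioo (-1 : ℝ) 0)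
    (hp : 0 < p) (hq : 0 < q) (hs : 0 < s) :
    ∫ t in Set.Ioo (0 : ℝ) 1, p * q * (1 - t) ^ (1 - ε) *
      ((1 + 2 * ε * t) * ((1 - t) * (r * p * q) + t * s) ^ (-(3 + ε))
        - (3 + ε) * t * s * ((1 - t) * (r * p * q) + t * s) ^ (-(4 + ε))) = 0 := by
  obtain ⟨he1, he0⟩ := hε
  set Q : ℝ → ℝ := fun t => (1 - t) * (r * p * q) + t * s with hQ
  set g : ℝ → ℝ := fun t => p * q * (1 - t) ^ (1 - ε) *
      ((1 + 2 * ε * t) * Q t ^ (-(3 + ε)) - (3 + ε) * t * s * Q t ^ (-(4 + ε))) with hg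
  change ∫ t in Set.Ioo (0 : ℝ) 1, g t = 0
  have hQ0 : ∀ t ∈ Set.Icc (0 : ℝ) 1, 0 < Q t := by
    intro t ht
    have h3 : 0 < r * p * q := by positivity
    simp only [hQ]
    rcases ht.1.eq_or_lt with h | h
    · subst h; linarith
    · have : 0 ≤ 1 - t := by linarith [ht.2]
      positivity
  set G : ℝ → ℝ := fun t => p * q * (t * ((1 - t) ^ (2 - ε) * Q t ^ (-(3 + ε)))) with hG
  have hderiv : ∀ t ∈ Set.Ioo (0 : ℝ) 1, HasDerivAt G (g t) t := by
    intro t ht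
    have h1 : 0 < 1 - t := by linarith [ht.2]
    have hQt := hQ0 t ⟨ht.1.le, ht.2.le⟩
    have d1 : HasDerivAt (fun t : ℝ => 1 - t) (-1) t := by
      simpa using (hasDerivAt_id t).const_sub 1
    have d2 : HasDerivAt Q (-1 * (r * p * q) + 1 * s) t :=
      (d1.mul_const _).add ((hasDerivAt_id t).mul_const s)
    have d3 := d1.rpow_const (p := 2 - ε) (Or.inl h1.ne')
    have d4 := d2.rpow_const (p := -(3 + ε)) (Or.inl hQt.ne')
    have d5 := ((hasDerivAt_id t).mul (d3.mul d4)).const_mul (p * q)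
    refine d5.congr_deriv ?_
    have e1 : (1 - t) ^ (2 - ε) = (1 - t) ^ (1 - ε) * (1 - t) := by
      rw [← Real.rpow_add_one h1.ne']; ring_nf
    have e2 : Q t ^ (-(3 + ε)) = Q t ^ (-(4 + ε)) * Q t := by
      rw [← Real.rpow_add_one hQt.ne']; ring_nf
    have e3 : 2 - ε - 1 = 1 - ε := by ring
    have e4 : -(3 + ε) - 1 = -(4 + ε) := by ring
    simp only [hg, id, Pi.mul_apply]
    rw [e3, e4, e1, e2]
    simp only [hQ]
    ring
  have hcont : ∀ t ∈ Set.Icc (0 : ℝ) 1, ContinuousAt G t := by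
    intro t ht
    have hQt := hQ0 t ht
    have c1 : ContinuousAt Q t := by simp only [hQ]; fun_prop
    have c2 : ContinuousAt (fun t : ℝ => (1 - t) ^ (2 - ε)) t :=
      ContinuousAt.rpow_const (by fun_prop) (Or.inr (by linarith))
    exact continuousAt_const.mul
      (continuousAt_id.mul (c2.mul (c1.rpow_const (Or.inl hQt.ne'))))
  by_cases hint : IntegrableOn g (Set.Ioo 0 1)
  · have hG0 : G 0 = 0 := by simp [hG]
    have hG1 : G 1 = 0 := by
      simp [hG, Real.zero_rpow (by linarith : 2 - ε ≠ 0)]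
    have h0 := (hcont 0 (by simp)).tendsto.mono_left (nhdsWithin_le_nhds (s := Set.Ioi 0))
    have h1 := (hcont 1 (by simp)).tendsto.mono_left (nhdsWithin_le_nhds (s := Set.Iio 1))
    rw [hG0] at h0
    rw [hG1] at h1
    have := intervalIntegral.integral_eq_sub_of_hasDerivAt_of_tendsto one_pos hderiv
      ((intervalIntegrable_iff_integrableOn_Ioo_of_le zero_le_one).2 hint) h0 h1
    rwa [intervalIntegral.integral_of_le zero_le_one, integral_Ioc_eq_integral_Ioo,
      sub_zero] at this
  · exact integral_undef hint

lemma boxZ4_pos {z : ℝ × ℝ × ℝ} (hz : z ∈ boxDelta) : 0 < boxZ4 z := by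
  unfold boxZ4
  linarith [hz.2.2.2]

lemma boxF_pos {r : ℝ} (hr : 0 < r) {z : ℝ × ℝ × ℝ} (hz : z ∈ boxDelta) : 0 < boxF r z := by
  have h4 := boxZ4_pos hz
  obtain ⟨h1, h2, h3, -⟩ := hz
  unfold boxF
  positivity

/-- Weighted AM-GM bounds the box integrand by a Dirichlet density. -/
lemma mul_boxF_rpow_le {r a : ℝ} (hr : 0 < r) (ha : 0 < a) {z : ℝ × ℝ × ℝ}
    (hz : z ∈ boxDelta) :
    z.1 * z.2.2 * boxF r z ^ (-(3 * a)) ≤ r ^ (-(2 * a)) *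
      (z.1 ^ (2 - 2 * a - 1) * (z.2.1 ^ (1 - a - 1) *
        (z.2.2 ^ (2 - 2 * a - 1) * boxZ4 z ^ (1 - a - 1)))) := by
  have h4 := boxZ4_pos hz
  obtain ⟨h1, h2, h3, -⟩ := hz
  set w := boxZ4 z
  have hu : 0 < r * z.1 * z.2.2 := by positivity
  have hv : 0 < z.2.1 * w := by positivity
  have hF : (r * z.1 * z.2.2) ^ (2 / 3 : ℝ) * (z.2.1 * w) ^ (1 / 3 : ℝ) ≤ boxF r z := by
    have := Real.geom_mean_le_arith_mean2_weighted (w₁ := 2 / 3) (w₂ := 1 / 3)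
      (by norm_num) (by norm_num) hu.le hv.le (by norm_num)
    unfold boxF
    linarith
  have hpow := Real.rpow_le_rpow_of_nonpos (by positivity) hF (by linarith : -(3 * a) ≤ 0)
  rw [Real.mul_rpow (by positivity) (by positivity), ← Real.rpow_mul hu.le,
    ← Real.rpow_mul hv.le, Real.mul_rpow (by positivity) h3.le, Real.mul_rpow hr.le h1.le,
    Real.mul_rpow h2.le h4.le,
    show 2 / 3 * -(3 * a) = -(2 * a) by ring, show 1 / 3 * -(3 * a) = -a by ring] at hpow
  have e : ∀ x : ℝ, 0 < x → x ^ (2 - 2 * a - 1) = x * x ^ (-(2 * a)) := fun x hx => by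
    rw [show 2 - 2 * a - 1 = -(2 * a) + 1 by ring, Real.rpow_add_one hx.ne', mul_comm]
  rw [e _ h1, e _ h3, show 1 - a - 1 = -a by ring]
  refine (mul_le_mul_of_nonneg_left hpow (by positivity)).trans_eq ?_
  ring

lemma integrableOn_mul_boxF_rpow {r ε : ℝ} (hr : 0 < r) (hε : ε ∈ Set.Ioo (-1 : ℝ) 0) :
    IntegrableOn (fun z => z.1 * z.2.2 * boxF r z ^ (-(3 + ε))) boxDelta volume := by
  obtain ⟨he1, he0⟩ := hε
  have hD := (integrableOn_dirichlet (a := 2 - 2 * ((3 + ε) / 3)) (b := 1 - (3 + ε) / 3)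
    (c := 2 - 2 * ((3 + ε) / 3)) (d := 1 - (3 + ε) / 3) (by linarith) (by linarith)
    (by linarith) (by linarith)).const_mul (r ^ (-(2 * ((3 + ε) / 3))))
  refine Integrable.mono' hD (Measurable.aestronglyMeasurable (by fun_prop))
    (ae_restrict_of_forall_mem measurableSet_boxDelta fun z hz => ?_)
  have hF := boxF_pos hr hz
  have h := mul_boxF_rpow_le hr (by linarith : 0 < (3 + ε) / 3) hz
  rw [show 3 * ((3 + ε) / 3) = 3 + ε by ring] at h
  obtain ⟨h1, h2, h3, -⟩ := hz
  rwa [Real.norm_of_nonneg (by positivity)]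

lemma integrableOn_mul_mul_boxF_rpow {r ε : ℝ} (hr : 0 < r) (hε : ε ∈ Set.Ioo (-1 : ℝ) 0) :
    IntegrableOn (fun z => z.1 * z.2.1 * z.2.2 * boxF r z ^ (-(3 + ε))) boxDelta volume := by
  refine Integrable.mono' (integrableOn_mul_boxF_rpow hr hε)
    (Measurable.aestronglyMeasurable (by fun_prop))
    (ae_restrict_of_forall_mem measurableSet_boxDelta fun z hz => ?_)
  have hF := boxF_pos hr hz
  obtain ⟨h1, h2, h3, h4⟩ := hz
  rw [Real.norm_of_nonneg (by positivity)]
  have h : 0 < z.1 * z.2.2 * boxF r z ^ (-(3 + ε)) := by positivity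
  nlinarith [mul_pos h (by linarith : 0 < 1 - z.2.1)]

lemma integrableOn_mul_boxZ4_mul_boxF_rpow {r ε : ℝ} (hr : 0 < r)
    (hε : ε ∈ Set.Ioo (-1 : ℝ) 0) :
    IntegrableOn (fun z => z.1 * z.2.1 * z.2.2 * boxZ4 z * boxF r z ^ (-(4 + ε)))
      boxDelta volume := by
  refine Integrable.mono' (integrableOn_mul_boxF_rpow hr hε)
    (Measurable.aestronglyMeasurable (by fun_prop))
    (ae_restrict_of_forall_mem measurableSet_boxDelta fun z hz => ?_)
  have hF := boxF_pos hr hz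
  have hw := boxZ4_pos hz
  obtain ⟨h1, h2, h3, h4⟩ := hz
  rw [Real.norm_of_nonneg (by positivity), show -(3 + ε) = -(4 + ε) + 1 by ring,
    Real.rpow_add_one hF.ne']
  have hle : z.2.1 * boxZ4 z ≤ boxF r z := by
    unfold boxF
    have : 0 < r * z.1 * z.2.2 := by positivity
    linarith
  have h : 0 < z.1 * z.2.2 * boxF r z ^ (-(4 + ε)) := by positivity
  nlinarith [mul_le_mul_of_nonneg_left hle h.le]

/-- The total derivative underlying the integration-by-parts identity has zero integral. -/
lemma setIntegral_boxDelta_divergence_eq_zero {r ε : ℝ} (hr : 0 < r)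
    (hε : ε ∈ Set.Ioo (-1 : ℝ) 0) :
    ∫ z in boxDelta, (z.1 * z.2.2 * boxF r z ^ (-(3 + ε))
      + 2 * ε * (z.1 * z.2.1 * z.2.2 * boxF r z ^ (-(3 + ε)))
      - (3 + ε) * (z.1 * z.2.1 * z.2.2 * boxZ4 z * boxF r z ^ (-(4 + ε)))) = 0 := by
  set f : ℝ × ℝ × ℝ → ℝ := fun z => z.1 * z.2.2 * boxF r z ^ (-(3 + ε))
      + 2 * ε * (z.1 * z.2.1 * z.2.2 * boxF r z ^ (-(3 + ε)))
      - (3 + ε) * (z.1 * z.2.1 * z.2.2 * boxZ4 z * boxF r z ^ (-(4 + ε))) with hf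
  have hfm : Measurable f := by fun_prop
  have hfi : IntegrableOn f boxDelta :=
    ((integrableOn_mul_boxF_rpow hr hε).add
      ((integrableOn_mul_mul_boxF_rpow hr hε).const_mul _)).sub
      ((integrableOn_mul_boxZ4_mul_boxF_rpow hr hε).const_mul _)
  rw [← integral_indicator measurableSet_boxDelta,
    integral_cone_coordinates _ (hfm.indicator measurableSet_boxDelta)
      (hfi.integrable_indicator measurableSet_boxDelta)
      fun z hz => Set.indicator_of_notMem
        (fun h => hz ⟨h.2.1, by linarith [h.1, h.2.2.1, h.2.2.2]⟩) _]
  refine integral_eq_zero_of_ae (Filter.Eventually.of_forall fun x => ?_)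
  by_cases hx : 0 < x.1 ∧ 0 < x.2 ∧ x.1 + x.2 < 1
  · obtain ⟨hx1, hx2, hx3⟩ := hx
    refine (setIntegral_congr_fun measurableSet_Ioo fun t ht => ?_).trans
      (integral_ray_eq_zero hr hε hx1 hx2 (by linarith : 0 < 1 - x.1 - x.2))
    have h1 : 0 < 1 - t := by linarith [ht.2]
    have hmem : ((1 - t) * x.1, t, (1 - t) * x.2) ∈ boxDelta :=
      ⟨mul_pos h1 hx1, ht.1, mul_pos h1 hx2, by
        change (1 - t) * x.1 + t + (1 - t) * x.2 < 1
        nlinarith [mul_pos h1 (by linarith : 0 < 1 - x.1 - x.2)]⟩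
    have hQ : 0 < (1 - t) * (r * x.1 * x.2) + t * (1 - x.1 - x.2) := by
      have := mul_pos ht.1 (by linarith : 0 < 1 - x.1 - x.2)
      positivity
    have hF : boxF r ((1 - t) * x.1, t, (1 - t) * x.2) =
        (1 - t) * ((1 - t) * (r * x.1 * x.2) + t * (1 - x.1 - x.2)) := by
      simp only [boxF, boxZ4]
      ring
    have hZ : boxZ4 ((1 - t) * x.1, t, (1 - t) * x.2) = (1 - t) * (1 - x.1 - x.2) := by
      simp only [boxZ4]
      ring
    have e1 : (1 - t) ^ (1 - ε) = (1 - t) ^ (-(3 + ε)) * (1 - t) ^ 4 := by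
      rw [← Real.rpow_natCast, ← Real.rpow_add h1]
      norm_num
      ring_nf
    have e2 : (1 - t) ^ (-(3 + ε)) = (1 - t) ^ (-(4 + ε)) * (1 - t) := by
      rw [← Real.rpow_add_one h1.ne']
      ring_nf
    simp only [Set.indicator_of_mem hmem, hf]
    rw [hF, hZ, Real.mul_rpow h1.le hQ.le, Real.mul_rpow h1.le hQ.le, e1, e2]
    ring
  · refine setIntegral_eq_zero_of_forall_eq_zero fun t ht => ?_
    have h1 : 0 < 1 - t := by linarith [ht.2]
    have hmem : ((1 - t) * x.1, t, (1 - t) * x.2) ∉ boxDelta := by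
      rintro ⟨g1, -, g3, g4⟩
      refine hx ⟨pos_of_mul_pos_right g1 h1.le, pos_of_mul_pos_right g3 h1.le, ?_⟩
      change (1 - t) * x.1 + t + (1 - t) * x.2 < 1 at g4
      exact lt_of_mul_lt_mul_left (by linarith : (1 - t) * (x.1 + x.2) < (1 - t) * 1) h1.le
    simp only [Set.indicator_of_notMem hmem, mul_zero]

/-- IBP identity `(3+ε) I(2,2,2,2;2ε) = I(2,1,2,1;2ε) + 2ε I(2,2,2,1;−1+2ε)`
for the one-loop massless box, in Feynman parameter space. -/
theorem box_ibp_2222 (r ε : ℝ) (hr : 0 < r) (hε : ε ∈ Set.Ioo (-1 : ℝ) 0) :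
    IntegrableOn (fun z => z.1 * z.2.1 * z.2.2 * boxZ4 z * boxF r z ^ (-(4 + ε))) boxDelta volume ∧
    IntegrableOn (fun z => z.1 * z.2.2 * boxF r z ^ (-(3 + ε))) boxDelta volume ∧
    IntegrableOn (fun z => z.1 * z.2.1 * z.2.2 * boxF r z ^ (-(3 + ε))) boxDelta volume ∧
    (3 + ε) * ∫ z in boxDelta, z.1 * z.2.1 * z.2.2 * boxZ4 z * boxF r z ^ (-(4 + ε)) =
      (∫ z in boxDelta, z.1 * z.2.2 * boxF r z ^ (-(3 + ε)))
        + 2 * ε * ∫ z in boxDelta, z.1 * z.2.1 * z.2.2 * boxF r z ^ (-(3 + ε)) := by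
  have i1 := integrableOn_mul_boxZ4_mul_boxF_rpow hr hε
  have i2 := integrableOn_mul_boxF_rpow hr hε
  have i3 := integrableOn_mul_mul_boxF_rpow hr hε
  refine ⟨i1, i2, i3, ?_⟩
  have h := setIntegral_boxDelta_divergence_eq_zero hr hε
  rw [integral_sub (i2.fun_add (i3.const_mul _)) (i1.const_mul _), integral_add i2 (i3.const_mul _),
    integral_const_mul, integral_const_mul] at h
  linarith
end

section
/- Fix r > 0 and ε ∈ (−1,0). On the open simplex Δ = {(z₁,z₂,z₃) ∈ (0,∞)³ : z₁+z₂+z₃ < 1}, with z₄ := 1−z₁−z₂−z₃ and F := r·z₁z₃ + z₂z₄ > 0, the functions z₁²z₂z₃²z₄·F^{−(5+ε)}, z₁z₃·F^{−(3+ε)}, z₂z₄·F^{−(3+ε)} and z₁z₂z₃z₄·F^{−(4+ε)} are Lebesgue integrable on Δ, and (3+ε)(4+ε)·r·(1+r)·∫_Δ z₁²z₂z₃²z₄ F^{−(5+ε)} = ∫_Δ z₁z₃ F^{−(3+ε)} − ∫_Δ z₂z₄ F^{−(3+ε)} + (3+ε)(1+ε+3r)·∫_Δ z₁z₂z₃z₄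 F^{−(4+ε)}. -/
open MeasureTheory

open Set Filter Topology

theorem integrableOn_rpow_mul_one_add_rpow {p q : ℝ} (hp : -1 < p) (hq : q ≤ 0)
    (hpq : p + q < -1) :
    IntegrableOn (fun x : ℝ => x ^ p * (1 + x) ^ q) (Ioi 0) := by
  have hcont : ContinuousOn (fun x : ℝ => x ^ p * (1 + x) ^ q) (Ioi 0) := by
    intro x (hx : 0 < x)
    exact ((Real.continuousAt_rpow_const x p (Or.inl hx.ne')).mul
      ((continuousAt_const.add continuousAt_id).rpow_const
        (Or.inl (show 1 + x ≠ 0 by positivity)))).continuousWithinAt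
  rw [← Ioc_union_Ioi_eq_Ioi zero_le_one, integrableOn_union]
  constructor
  · have h : IntegrableOn (fun x : ℝ => x ^ p) (Ioc 0 1) :=
      (intervalIntegrable_iff_integrableOn_Ioc_of_le zero_le_one).1
        (intervalIntegral.intervalIntegrable_rpow' hp)
    refine Integrable.mono' h ((hcont.mono Ioc_subset_Ioi_self).aestronglyMeasurable
      measurableSet_Ioc) ?_
    filter_upwards [ae_restrict_mem measurableSet_Ioc] with x hx
    have hx0 : 0 < x := hx.1
    rw [Real.norm_of_nonneg (by positivity)]
    exact mul_le_of_le_one_right (by positivity)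
      (Real.rpow_le_one_of_one_le_of_nonpos (by linarith) hq)
  · have h := integrableOn_Ioi_rpow_of_lt hpq zero_lt_one
    refine Integrable.mono' h ((hcont.mono (Ioi_subset_Ioi zero_le_one)).aestronglyMeasurable
      measurableSet_Ioi) ?_
    filter_upwards [ae_restrict_mem measurableSet_Ioi] with x hx
    have hx0 : 0 < x := lt_trans zero_lt_one hx
    rw [Real.norm_of_nonneg (by positivity), Real.rpow_add hx0]
    exact mul_le_mul_of_nonneg_left
      (Real.rpow_le_rpow_of_nonpos hx0 (by linarith) hq) (by positivity)

/-- The weight in the variables `u = z₁/z₄`, `w = z₂z₄/(z₁z₃)` multiplying functions of `w`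
when the box integrals are pulled back to the quadrant. -/
noncomputable def boxKernel (r ε u w : ℝ) : ℝ :=
  u ^ (-1 - ε) * (1 + u) ^ ε * (1 + u * w) ^ ε * (r + w) ^ (-3 - ε)

theorem boxKernel_le {r ε u w : ℝ} (hr : 0 < r) (hε : ε ∈ Ioo (-1 : ℝ) 0) (hu : 0 < u)
    (hw : 0 < w) :
    boxKernel r ε u w * (1 + w) ≤ min 1 r ^ (-3 - ε) *
      ((u ^ (-1 - ε) * (1 + u) ^ (2 * ε)) *
        (w ^ (0 : ℝ) * (1 + w) ^ (-2 - ε) + w ^ ε * (1 + w) ^ (-2 - ε))) := by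
  obtain ⟨h1, h2⟩ := hε
  have hm : 0 < min 1 r := lt_min one_pos hr
  have e1 : (1 + u * w) ^ ε ≤ (1 + u) ^ ε * (1 + w ^ ε) := by
    rcases le_total 1 w with h | h
    · calc (1 + u * w) ^ ε ≤ (1 + u) ^ ε :=
            Real.rpow_le_rpow_of_nonpos (by positivity) (by nlinarith) h2.le
        _ ≤ _ := le_mul_of_one_le_right (by positivity) (by
            have : 0 < w ^ ε := by positivity
            linarith)
    · calc (1 + u * w) ^ ε ≤ ((1 + u) * w) ^ ε :=
            Real.rpow_le_rpow_of_nonpos (by positivity) (by nlinarith) h2.le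
        _ = (1 + u) ^ ε * w ^ ε := Real.mul_rpow (by positivity) hw.le
        _ ≤ _ := mul_le_mul_of_nonneg_left (by linarith) (by positivity)
  have e2 : (r + w) ^ (-3 - ε) ≤ min 1 r ^ (-3 - ε) * (1 + w) ^ (-3 - ε) := by
    rw [← Real.mul_rpow hm.le (by positivity)]
    refine Real.rpow_le_rpow_of_nonpos (by positivity) ?_ (by linarith)
    nlinarith [min_le_left 1 r, min_le_right 1 r]
  have e3 : (1 + w) ^ (-2 - ε) = (1 + w) ^ (-3 - ε) * (1 + w) := by
    rw [← Real.rpow_add_one (by positivity)]; congr 1; ring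
  have e4 : (1 + u) ^ (2 * ε) = (1 + u) ^ ε * (1 + u) ^ ε := by
    rw [← Real.rpow_add (by positivity)]; congr 1; ring
  rw [e3, e4, Real.rpow_zero, boxKernel]
  calc _ ≤ u ^ (-1 - ε) * (1 + u) ^ ε * ((1 + u) ^ ε * (1 + w ^ ε)) *
        (min 1 r ^ (-3 - ε) * (1 + w) ^ (-3 - ε)) * (1 + w) := by gcongr
    _ = _ := by ring

theorem boxKernel_nonneg {r ε u w : ℝ} (hr : 0 < r) (hu : 0 < u) (hw : 0 < w) :
    0 ≤ boxKernel r ε u w := by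
  unfold boxKernel; positivity

theorem integrable_boxKernel_mul {r ε : ℝ} (hr : 0 < r) (hε : ε ∈ Ioo (-1 : ℝ) 0)
    {g : ℝ × ℝ → ℝ} (hg : ContinuousOn g (Ioi 0 ×ˢ Ioi 0)) (C : ℝ)
    (hgC : ∀ u > 0, ∀ w > 0, |g (u, w)| ≤ C * (1 + w)) :
    Integrable (fun x : ℝ × ℝ => boxKernel r ε x.1 x.2 * g x)
      ((volume.restrict (Ioi 0)).prod (volume.restrict (Ioi 0))) := by
  obtain ⟨h1, h2⟩ := hε
  have iu := integrableOn_rpow_mul_one_add_rpow (p := -1 - ε) (q := 2 * ε)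
    (by linarith) (by linarith) (by linarith)
  have iw := (integrableOn_rpow_mul_one_add_rpow (p := 0) (q := -2 - ε)
    (by linarith) (by linarith) (by linarith)).add
    (integrableOn_rpow_mul_one_add_rpow (p := ε) (q := -2 - ε)
    (by linarith) (by linarith) (by linarith))
  have i := ((iu.mul_prod iw).const_mul (min 1 r ^ (-3 - ε))).const_mul C
  refine i.mono' ?_ ?_
  · rw [Measure.prod_restrict]
    refine ContinuousOn.aestronglyMeasurable (ContinuousOn.mul ?_ hg)
      (measurableSet_Ioi.prod measurableSet_Ioi)
    rintro ⟨u, w⟩ ⟨hu, hw⟩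
    simp only [mem_Ioi] at hu hw
    have : ContinuousAt (fun x : ℝ × ℝ => boxKernel r ε x.1 x.2) (u, w) := by
      unfold boxKernel
      refine ContinuousAt.mul (ContinuousAt.mul (ContinuousAt.mul ?_ ?_) ?_) ?_
      all_goals
        refine ContinuousAt.rpow_const (by fun_prop) (Or.inl ?_)
        dsimp only
        positivity
    exact this.continuousWithinAt
  · rw [Measure.prod_restrict]
    filter_upwards [ae_restrict_mem (measurableSet_Ioi.prod measurableSet_Ioi)]
    rintro ⟨u, w⟩ ⟨hu, hw⟩
    simp only [mem_Ioi] at hu hw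
    have hk := boxKernel_nonneg (ε := ε) hr hu hw
    have hg' := hgC u hu w hw
    have hC : 0 ≤ C := by
      by_contra h
      have := abs_nonneg (g (u, w))
      nlinarith [mul_pos (neg_pos.2 (not_le.1 h)) (show 0 < 1 + w by positivity)]
    rw [norm_mul, Real.norm_of_nonneg hk, Real.norm_eq_abs]
    calc _ ≤ boxKernel r ε u w * (C * (1 + w)) := by gcongr
      _ = C * (boxKernel r ε u w * (1 + w)) := by ring
      _ ≤ _ := mul_le_mul_of_nonneg_left (boxKernel_le hr ⟨h1, h2⟩ hu hw) hC

theorem det_prod_prod (L : (ℝ × ℝ × ℝ) →L[ℝ] (ℝ × ℝ × ℝ)) :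
    L.det = Matrix.det !![(L (1, 0, 0)).1, (L (0, 1, 0)).1, (L (0, 0, 1)).1;
      (L (1, 0, 0)).2.1, (L (0, 1, 0)).2.1, (L (0, 0, 1)).2.1;
      (L (1, 0, 0)).2.2, (L (0, 1, 0)).2.2, (L (0, 0, 1)).2.2] := by
  let e : (ℝ × ℝ × ℝ) ≃ₗ[ℝ] (Fin 3 → ℝ) :=
    { toFun := fun z => ![z.1, z.2.1, z.2.2]
      invFun := fun v => (v 0, v 1, v 2)
      left_inv := fun z => rfl
      right_inv := fun v => by ext i; fin_cases i <;> rfl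
      map_add' := fun x y => by ext i; fin_cases i <;> rfl
      map_smul' := fun c x => by ext i; fin_cases i <;> rfl }
  rw [ContinuousLinearMap.det, ← LinearMap.det_toMatrix (Module.Basis.ofEquivFun e)]
  congr 1
  ext i j
  rw [LinearMap.toMatrix_apply]
  have s0 : e.symm (Pi.single 0 1) = (1, 0, 0) := rfl
  have s1 : e.symm (Pi.single 1 1) = (0, 1, 0) := rfl
  have s2 : e.symm (Pi.single 2 1) = (0, 0, 1) := rfl
  have he : ∀ z, e z = ![z.1, z.2.1, z.2.2] := fun z => rfl
  fin_cases i <;> fin_cases j <;> simp [Module.Basis.ofEquivFun, s0, s1, s2, he]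

theorem HasFDerivAt.real_div {E : Type*} [NormedAddCommGroup E] [NormedSpace ℝ E]
    {f g : E → ℝ} {f' g' : E →L[ℝ] ℝ} {x : E} (hf : HasFDerivAt f f' x)
    (hg : HasFDerivAt g g' x) (hx : g x ≠ 0) :
    HasFDerivAt (fun y => f y / g y) ((g x)⁻¹ • f' - (f x / g x ^ 2) • g') x := by
  have h := hf.mul ((hasDerivAt_inv hx).comp_hasFDerivAt x hg)
  refine (h.congr_fderiv ?_).congr_of_eventuallyEq (Eventually.of_forall fun y => ?_)
  · ext v
    simp
    field_simp
    ring
  · simp [div_eq_mul_inv]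

/-- Parametrisation of the simplex by the octant, with `b = (z₁+z₄)/(z₂+z₃)`, `u = z₁/z₄` and
`w = z₂z₄/(z₁z₃)`. -/
noncomputable def boxParam (p : ℝ × ℝ × ℝ) : ℝ × ℝ × ℝ :=
  (p.1 * p.2.1 / ((1 + p.1) * (1 + p.2.1)),
    p.2.1 * p.2.2 / ((1 + p.1) * (1 + p.2.1 * p.2.2)),
    1 / ((1 + p.1) * (1 + p.2.1 * p.2.2)))

/-- The inverse of `boxParam` on the open simplex. -/
noncomputable def boxParamInv (z : ℝ × ℝ × ℝ) : ℝ × ℝ × ℝ :=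
  ((z.1 + boxZ4 z) / (z.2.1 + z.2.2), z.1 / boxZ4 z, z.2.1 * boxZ4 z / (z.1 * z.2.2))

theorem boxZ4_boxParam {b u w : ℝ} (hb : 0 < b) (hu : 0 < u) (hw : 0 < w) :
    boxZ4 (boxParam (b, u, w)) = b / ((1 + b) * (1 + u)) := by
  simp only [boxZ4, boxParam]
  field_simp
  ring

theorem boxParamInv_boxParam {b u w : ℝ} (hb : 0 < b) (hu : 0 < u) (hw : 0 < w) :
    boxParamInv (boxParam (b, u, w)) = (b, u, w) := by
  simp only [boxParamInv, boxZ4_boxParam hb hu hw]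
  simp only [boxParam]
  refine Prod.ext ?_ (Prod.ext ?_ ?_)
  · field_simp
    ring
  · field_simp
  · field_simp

theorem boxParam_image : boxParam '' (Ioi 0 ×ˢ Ioi 0 ×ˢ Ioi 0) = boxDelta := by
  ext z
  constructor
  · rintro ⟨⟨b, u, w⟩, ⟨hb, hu, hw⟩, rfl⟩
    simp only [mem_Ioi] at hb hu hw
    have h4 : 0 < boxZ4 (boxParam (b, u, w)) := by
      rw [boxZ4_boxParam hb hu hw]; positivity
    refine ⟨?_, ?_, ?_, ?_⟩
    · simp only [boxParam]; positivity
    · simp only [boxParam]; positivity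
    · simp only [boxParam]; positivity
    · unfold boxZ4 at h4; linarith
  · obtain ⟨z1, z2, z3⟩ := z
    rintro ⟨h1, h2, h3, h4⟩
    simp only at h1 h2 h3 h4
    obtain ⟨t, ht⟩ : ∃ t, t = 1 - z1 - z2 - z3 := ⟨_, rfl⟩
    have ht0 : 0 < t := by linarith
    refine ⟨boxParamInv (z1, z2, z3), ?_, ?_⟩
    · simp only [boxParamInv, boxZ4, ← ht]
      refine ⟨?_, ?_, ?_⟩ <;> simp only [mem_Ioi] <;> positivity
    · have e1 : 1 + (z1 + t) / (z2 + z3) = 1 / (z2 + z3) := by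
        field_simp; linarith
      have e2 : 1 + z1 / t * (z2 * t / (z1 * z3)) = (z2 + z3) / z3 := by
        field_simp; ring
      have e3 : 1 + z1 / t = (1 - z2 - z3) / t := by
        field_simp; linarith
      have h5 : 1 - z2 - z3 = z1 + t := by linarith
      simp only [boxParamInv, boxZ4, ← ht, boxParam, e1, e2, e3, h5]
      refine Prod.ext ?_ (Prod.ext ?_ ?_) <;> field_simp

theorem hasFDerivAt_boxParam {b u w : ℝ} (hb : 0 < b) (hu : 0 < u) (hw : 0 < w) :
    ∃ L : (ℝ × ℝ × ℝ) →L[ℝ] (ℝ × ℝ × ℝ), HasFDerivAt boxParam L (b, u, w) ∧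
      |L.det| = b * u / ((1 + b) ^ 4 * (1 + u) ^ 2 * (1 + u * w) ^ 2) := by
  have db : HasFDerivAt (fun p : ℝ × ℝ × ℝ => p.1) (ContinuousLinearMap.fst ℝ ℝ (ℝ × ℝ))
    (b, u, w) := hasFDerivAt_fst
  have ds : HasFDerivAt (fun p : ℝ × ℝ × ℝ => p.2) (ContinuousLinearMap.snd ℝ ℝ (ℝ × ℝ))
    (b, u, w) := hasFDerivAt_snd
  have du := ds.fst
  have dw := ds.snd
  have n1 : (1 + b) * (1 + u) ≠ 0 := by positivity
  have n2 : (1 + b) * (1 + u * w) ≠ 0 := by positivity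
  have d1 := (db.mul du).real_div ((db.const_add 1).mul (du.const_add 1)) n1
  have d2 := (du.mul dw).real_div ((db.const_add 1).mul ((du.mul dw).const_add 1)) n2
  have d3 := (hasFDerivAt_const (1 : ℝ) (b, u, w)).real_div
    ((db.const_add 1).mul ((du.mul dw).const_add 1)) n2
  refine ⟨_, d1.prodMk (d2.prodMk d3), ?_⟩
  have hpos : 0 ≤ b * u / ((1 + b) ^ 4 * (1 + u) ^ 2 * (1 + u * w) ^ 2) := by positivity
  rw [← abs_of_nonneg hpos, det_prod_prod, Matrix.det_fin_three]
  rw [abs_eq_abs]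
  simp
  right
  field_simp
  ring

theorem boxF_boxParam {r b u w : ℝ} (hb : 0 < b) (hu : 0 < u) (hw : 0 < w) :
    boxF r (boxParam (b, u, w)) =
      b * u * (r + w) / ((1 + b) ^ 2 * ((1 + u) * (1 + u * w))) := by
  simp only [boxF, boxZ4_boxParam hb hu hw]
  simp only [boxParam]
  field_simp

theorem jacobian_mul_integrand {r ε b u w : ℝ} (hr : 0 < r) (hb : 0 < b) (hu : 0 < u)
    (hw : 0 < w) :
    b * u / ((1 + b) ^ 4 * (1 + u) ^ 2 * (1 + u * w) ^ 2) *
      ((boxParam (b, u, w)).1 * (boxParam (b, u, w)).2.2 *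
        boxF r (boxParam (b, u, w)) ^ (-(3 + ε))) =
      (b ^ (-1 - ε) * (1 + b) ^ (2 * ε)) * boxKernel r ε u w := by
  have pw : 0 < 1 + u * w := by positivity
  have pu : 0 < 1 + u := by positivity
  have pb : 0 < 1 + b := by positivity
  have pr : 0 < r + w := by positivity
  have h2 : ((1 + b) ^ 2) ^ (-(3 + ε)) = (1 + b) ^ (2 * ε) / (1 + b) ^ 6 * ((1 + b) ^ (2 * ε))⁻¹ *
      ((1 + b) ^ (2 * ε))⁻¹ := by
    rw [← Real.rpow_natCast (1 + b) 2, ← Real.rpow_mul pb.le, ← Real.rpow_neg pb.le,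
      ← Real.rpow_natCast (1 + b) 6, ← Real.rpow_sub pb, ← Real.rpow_add pb, ← Real.rpow_add pb]
    congr 1
    push_cast
    ring
  have h3 : ∀ x : ℝ, 0 < x → x ^ (-(3 + ε)) = (x ^ ε)⁻¹ / x ^ 3 := fun x hx => by
    rw [← Real.rpow_neg hx.le, ← Real.rpow_natCast x 3, ← Real.rpow_sub hx]
    congr 1
    push_cast
    ring
  have h4 : ∀ x : ℝ, 0 < x → x ^ (-1 - ε) = (x ^ ε)⁻¹ / x := fun x hx => by
    rw [← Real.rpow_neg hx.le, ← Real.rpow_sub_one hx.ne']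
    congr 1
    ring
  have h5 : (r + w) ^ (-3 - ε) = (r + w) ^ (-(3 + ε)) := by congr 1; ring
  rw [boxF_boxParam hb hu hw, Real.div_rpow (by positivity) (by positivity),
    Real.mul_rpow (by positivity) pr.le, Real.mul_rpow hb.le hu.le,
    Real.mul_rpow (by positivity) (by positivity), Real.mul_rpow pu.le pw.le, h2, boxKernel, h5,
    h3 b hb, h3 u hu, h3 _ pu, h3 _ pw, h4 b hb, h4 u hu]
  simp only [boxParam]
  have q1 : 0 < (1 + b) ^ (2 * ε) := by positivity
  have q2 : 0 < (1 + u) ^ ε := by positivity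
  have q3 : 0 < (1 + u * w) ^ ε := by positivity
  have q4 : 0 < b ^ ε := by positivity
  have q5 : 0 < u ^ ε := by positivity
  field_simp

theorem integral_boxDelta {r ε : ℝ} (hr : 0 < r) (hε : ε ∈ Ioo (-1 : ℝ) 0)
    {f : ℝ × ℝ × ℝ → ℝ} {g : ℝ → ℝ}
    (hf : ∀ z ∈ boxDelta, f z = z.1 * z.2.2 * boxF r z ^ (-(3 + ε)) * g (boxParamInv z).2.2)
    (hg : Integrable (fun x : ℝ × ℝ => boxKernel r ε x.1 x.2 * g x.2)
      ((volume.restrict (Ioi 0)).prod (volume.restrict (Ioi 0)))) :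
    IntegrableOn f boxDelta volume ∧
      ∫ z in boxDelta, f z = (∫ b in Ioi (0 : ℝ), b ^ (-1 - ε) * (1 + b) ^ (2 * ε)) *
        ∫ x, boxKernel r ε x.1 x.2 * g x.2
          ∂((volume.restrict (Ioi 0)).prod (volume.restrict (Ioi 0))) := by
  have hS : MeasurableSet (Ioi 0 ×ˢ Ioi 0 ×ˢ Ioi 0 : Set (ℝ × ℝ × ℝ)) :=
    measurableSet_Ioi.prod (measurableSet_Ioi.prod measurableSet_Ioi)
  have hd : ∀ p : ℝ × ℝ × ℝ, ∃ L : (ℝ × ℝ × ℝ) →L[ℝ] (ℝ × ℝ × ℝ),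
      p ∈ (Ioi 0 ×ˢ Ioi 0 ×ˢ Ioi 0 : Set (ℝ × ℝ × ℝ)) → HasFDerivAt boxParam L p ∧
      |L.det| = p.1 * p.2.1 / ((1 + p.1) ^ 4 * (1 + p.2.1) ^ 2 * (1 + p.2.1 * p.2.2) ^ 2) := by
    rintro ⟨b, u, w⟩
    by_cases h : (b, u, w) ∈ (Ioi 0 ×ˢ Ioi 0 ×ˢ Ioi 0 : Set (ℝ × ℝ × ℝ))
    · obtain ⟨L, hL⟩ := hasFDerivAt_boxParam h.1 h.2.1 h.2.2
      exact ⟨L, fun _ => hL⟩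
    · exact ⟨0, fun h' => absurd h' h⟩
  choose L hL using hd
  have hL' := fun p hp => ((hL p hp).1.hasFDerivWithinAt
    (s := (Ioi 0 ×ˢ Ioi 0 ×ˢ Ioi 0 : Set (ℝ × ℝ × ℝ))))
  have hinj : InjOn boxParam (Ioi 0 ×ˢ Ioi 0 ×ˢ Ioi 0 : Set (ℝ × ℝ × ℝ)) := by
    refine LeftInvOn.injOn (f₁' := boxParamInv) ?_
    rintro ⟨b, u, w⟩ ⟨hb, hu, hw⟩
    exact boxParamInv_boxParam hb hu hw
  have hpull : ∀ p ∈ (Ioi 0 ×ˢ Ioi 0 ×ˢ Ioi 0 : Set (ℝ × ℝ × ℝ)),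
      |(L p).det| • f (boxParam p) = (p.1 ^ (-1 - ε) * (1 + p.1) ^ (2 * ε)) *
        (boxKernel r ε p.2.1 p.2.2 * g p.2.2) := by
    rintro ⟨b, u, w⟩ hp
    have hm : boxParam (b, u, w) ∈ boxDelta := boxParam_image ▸ mem_image_of_mem _ hp
    rw [(hL _ hp).2, hf _ hm, boxParamInv_boxParam hp.1 hp.2.1 hp.2.2, smul_eq_mul, ← mul_assoc,
      jacobian_mul_integrand hr hp.1 hp.2.1 hp.2.2, mul_assoc]
  have hvol : (volume : Measure (ℝ × ℝ × ℝ)).restrict (Ioi 0 ×ˢ Ioi 0 ×ˢ Ioi 0) =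
      (volume.restrict (Ioi 0)).prod
        ((volume.restrict (Ioi 0)).prod (volume.restrict (Ioi 0))) := by
    rw [Measure.prod_restrict, Measure.prod_restrict]
    rfl
  have hHaar : (volume : Measure (ℝ × ℝ × ℝ)).IsAddHaarMeasure :=
    Measure.prod.instIsAddHaarMeasure (volume : Measure ℝ) (volume : Measure (ℝ × ℝ))
  rw [← boxParam_image, integrableOn_image_iff_integrableOn_abs_det_fderiv_smul volume hS hL' hinj,
    integral_image_eq_integral_abs_det_fderiv_smul volume hS hL' hinj,
    integrableOn_congr_fun hpull hS, setIntegral_congr_fun hS hpull, IntegrableOn, hvol]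
  have hb := integrableOn_rpow_mul_one_add_rpow (p := -1 - ε) (q := 2 * ε)
    (by linarith [hε.2]) (by linarith [hε.2]) (by linarith [hε.2])
  exact ⟨hb.mul_prod hg, integral_prod_mul (fun b : ℝ => b ^ (-1 - ε) * (1 + b) ^ (2 * ε))
    (fun x : ℝ × ℝ => boxKernel r ε x.1 x.2 * g x.2)⟩

/-- The coefficient of the kernel in the `u`-derivative part of the total divergence. -/
noncomputable def boxDivU (ε u w : ℝ) : ℝ :=
  -(w * ε * (-ε + u * (1 - w) + ε * (u ^ 2 * w)) / (1 + u * w) ^ 2)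

/-- The coefficient of the kernel in the combination of the four box integrals. -/
noncomputable def boxDiv (r ε w : ℝ) : ℝ :=
  (3 + ε) * (4 + ε) * r * (1 + r) * (w / (r + w) ^ 2) - 1 + w
    - (3 + ε) * (1 + ε + 3 * r) * (w / (r + w))

theorem integral_boxDivU {r ε w : ℝ} (hε : ε ∈ Ioo (-1 : ℝ) 0) (hw : 0 < w) :
    ∫ u in Ioi (0 : ℝ), boxKernel r ε u w * boxDivU ε u w = 0 := by
  obtain ⟨h1, h2⟩ := hε
  by_cases hint : IntegrableOn (fun u => boxKernel r ε u w * boxDivU ε u w) (Ioi 0)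
  swap
  · exact integral_undef hint
  set K : ℝ := -w * (r + w) ^ (-3 - ε) * ε with hK
  have hlim : Tendsto (fun u : ℝ => K * (u ^ (-ε) * (1 + u) ^ (1 + ε) * (1 + u * w) ^ (ε - 1)))
      atTop (𝓝 0) := by
    have hm : 0 < min 1 w := lt_min one_pos hw
    have h0 : Tendsto (fun u : ℝ => min 1 w ^ (ε - 1) * (1 + u) ^ (-(-ε))) atTop (𝓝 0) := by
      have := ((tendsto_rpow_neg_atTop (neg_pos.2 h2)).comp
        (tendsto_atTop_add_const_left atTop 1 tendsto_id)).const_mul (min 1 w ^ (ε - 1))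
      simpa using this
    have h3 : Tendsto (fun u : ℝ => u ^ (-ε) * (1 + u) ^ (1 + ε) * (1 + u * w) ^ (ε - 1))
        atTop (𝓝 0) := by
      refine squeeze_zero' ?_ ?_ h0
      · filter_upwards [eventually_gt_atTop 0] with u hu
        positivity
      · filter_upwards [eventually_gt_atTop 0] with u hu
        have e1 : u ^ (-ε) ≤ (1 + u) ^ (-ε) :=
          Real.rpow_le_rpow hu.le (by linarith) (by linarith)
        have e2 : (1 + u * w) ^ (ε - 1) ≤ min 1 w ^ (ε - 1) * (1 + u) ^ (ε - 1) := by
          rw [← Real.mul_rpow hm.le (by positivity)]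
          refine Real.rpow_le_rpow_of_nonpos (by positivity) ?_ (by linarith)
          nlinarith [min_le_left 1 w, min_le_right 1 w]
        have e3 : (1 + u) ^ (-(-ε)) = (1 + u) ^ (-ε) * (1 + u) ^ (1 + ε) * (1 + u) ^ (ε - 1) := by
          rw [← Real.rpow_add (by positivity), ← Real.rpow_add (by positivity)]
          congr 1
          ring
        calc _ ≤ (1 + u) ^ (-ε) * (1 + u) ^ (1 + ε) *
              (min 1 w ^ (ε - 1) * (1 + u) ^ (ε - 1)) := by gcongr
          _ = _ := by rw [e3]; ring
    simpa using h3.const_mul K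
  rw [integral_Ioi_of_hasDerivAt_of_tendsto
    (f := fun u : ℝ => K * (u ^ (-ε) * (1 + u) ^ (1 + ε) * (1 + u * w) ^ (ε - 1)))
    ?_ ?_ hint hlim]
  · simp [Real.zero_rpow (neg_pos.2 h2).ne']
  · refine (ContinuousAt.mul continuousAt_const (ContinuousAt.mul (ContinuousAt.mul ?_ ?_)
      ?_)).continuousWithinAt
    · exact Real.continuousAt_rpow_const 0 (-ε) (Or.inr (by linarith))
    · exact ContinuousAt.rpow_const (by fun_prop) (Or.inl (by simp))
    · exact ContinuousAt.rpow_const (by fun_prop) (Or.inl (by simp))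
  · intro u (hu : 0 < u)
    have pu : 0 < 1 + u := by positivity
    have pw : 0 < 1 + u * w := by positivity
    have d1 := (hasDerivAt_id u).rpow_const (p := -ε) (Or.inl hu.ne')
    have d2 := ((hasDerivAt_id u).const_add 1).rpow_const (p := 1 + ε) (Or.inl pu.ne')
    have d3 := (((hasDerivAt_id u).mul_const w).const_add 1).rpow_const (p := ε - 1)
      (Or.inl pw.ne')
    refine (((d1.mul d2).mul d3).const_mul K).congr_deriv ?_
    simp only [id, Pi.mul_apply, boxKernel, boxDivU, hK]
    rw [show -1 - ε = -ε - 1 by ring, show 1 + ε - 1 = ε by ring, add_comm 1 ε,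
      Real.rpow_sub_one hu.ne', Real.rpow_add_one pu.ne']
    simp only [Real.rpow_sub_one pw.ne']
    field_simp
    ring

theorem integral_boxDiv_sub_boxDivU {r ε u : ℝ} (hr : 0 < r) (hε : ε ∈ Ioo (-1 : ℝ) 0)
    (hu : 0 < u) :
    ∫ w in Ioi (0 : ℝ), boxKernel r ε u w * (boxDiv r ε w - boxDivU ε u w) = 0 := by
  obtain ⟨h1, h2⟩ := hε
  by_cases hint : IntegrableOn (fun w => boxKernel r ε u w * (boxDiv r ε w - boxDivU ε u w)) (Ioi 0)
  swap
  · exact integral_undef hint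
  set Q : ℝ → ℝ := fun w => w / (r + w) * ((1 - w) * (-(r + w) + (3 + ε) * w)
    + (1 + 2 * ε) * w * (r + w) + ε * (1 - w) * (r + w) * (u * w / (1 + u * w))) with hQ
  set K : ℝ := u ^ (-1 - ε) * (1 + u) ^ ε with hK
  have hKpos : 0 < K := by positivity
  have hbound : ∀ w > 0, |Q w| ≤ (5 * (1 + 1 / r) + 1) * (r + w) ^ 2 := by
    intro w hw
    have pr : 0 < r + w := by positivity
    set c := 1 + 1 / r with hc
    have hc0 : 0 < c := by positivity
    have a1 : |1 - w| ≤ c * (r + w) := by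
      have : c * (r + w) = r + w + 1 + w / r := by rw [hc]; field_simp; ring
      have : 0 < w / r := by positivity
      rw [abs_le]; constructor <;> linarith
    have a2 : |-(r + w) + (3 + ε) * w| ≤ 4 * (r + w) := by
      rw [abs_le]; constructor <;> nlinarith
    have a3 : |(1 + 2 * ε) * w| ≤ r + w := by
      rw [abs_le]; constructor <;> nlinarith
    have a4 : |u * w / (1 + u * w)| ≤ 1 := by
      rw [abs_of_nonneg (by positivity), div_le_one (by positivity)]; linarith
    have a5 : |w / (r + w)| ≤ 1 := by
      rw [abs_of_nonneg (by positivity), div_le_one (by positivity)]; linarith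
    have a6 : |ε| ≤ 1 := by rw [abs_le]; constructor <;> linarith
    calc |Q w| = |w / (r + w)| * |(1 - w) * (-(r + w) + (3 + ε) * w)
          + (1 + 2 * ε) * w * (r + w) + ε * (1 - w) * (r + w) * (u * w / (1 + u * w))| :=
          abs_mul _ _
      _ ≤ 1 * (|1 - w| * |-(r + w) + (3 + ε) * w| + |(1 + 2 * ε) * w| * |r + w|
          + |ε| * |1 - w| * |r + w| * |u * w / (1 + u * w)|) := by
          refine mul_le_mul a5 ?_ (abs_nonneg _) zero_le_one
          simp only [← abs_mul]
          exact abs_add_three _ _ _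
      _ ≤ 1 * (c * (r + w) * (4 * (r + w)) + (r + w) * (r + w)
          + 1 * (c * (r + w)) * (r + w) * 1) := by
          rw [abs_of_pos pr]
          gcongr
      _ = _ := by ring
  have hlim : Tendsto (fun w : ℝ => K * ((1 + u * w) ^ ε * (r + w) ^ (-3 - ε) * Q w))
      atTop (𝓝 0) := by
    have h0 : Tendsto (fun w : ℝ => (5 * (1 + 1 / r) + 1) * (r + w) ^ (-(1 + ε))) atTop (𝓝 0) := by
      have := ((tendsto_rpow_neg_atTop (show 0 < 1 + ε by linarith)).comp
        (tendsto_atTop_add_const_left atTop r tendsto_id)).const_mul (5 * (1 + 1 / r) + 1)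
      rw [mul_zero] at this
      exact this
    have h3 : Tendsto (fun w : ℝ => (1 + u * w) ^ ε * (r + w) ^ (-3 - ε) * Q w)
        atTop (𝓝 0) := by
      refine squeeze_zero_norm' ?_ h0
      filter_upwards [eventually_gt_atTop 0] with w hw
      have e1 : (1 + u * w) ^ ε ≤ 1 :=
        Real.rpow_le_one_of_one_le_of_nonpos (by nlinarith [mul_pos hu hw]) h2.le
      have e2 : (r + w) ^ (-(1 + ε)) = (r + w) ^ (-3 - ε) * (r + w) ^ 2 := by
        rw [← Real.rpow_natCast, ← Real.rpow_add (by positivity)]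
        congr 1
        push_cast
        ring
      rw [norm_mul, Real.norm_of_nonneg (by positivity), Real.norm_eq_abs]
      calc _ ≤ 1 * (r + w) ^ (-3 - ε) * ((5 * (1 + 1 / r) + 1) * (r + w) ^ 2) := by
            gcongr
            exact hbound w hw
        _ = _ := by rw [e2]; ring
    simpa using h3.const_mul K
  have hderiv : ∀ w ∈ Ici (0 : ℝ),
      HasDerivAt (fun w : ℝ => K * ((1 + u * w) ^ ε * (r + w) ^ (-3 - ε) * Q w))
        (boxKernel r ε u w * (boxDiv r ε w - boxDivU ε u w)) w := by
    intro w (hw : 0 ≤ w)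
    have pw : 0 < 1 + u * w := by positivity
    have pr : 0 < r + w := by positivity
    have i := hasDerivAt_id w
    have dw := (i.const_mul u).const_add 1
    have dr := i.const_add r
    have d1 := dw.rpow_const (p := ε) (Or.inl pw.ne')
    have d2 := dr.rpow_const (p := -3 - ε) (Or.inl pr.ne')
    have d3 := (i.div dr pr.ne').mul ((((i.const_sub 1).mul (dr.neg.add (i.const_mul (3 + ε)))).add
      ((i.const_mul (1 + 2 * ε)).mul dr)).add ((((i.const_sub 1).const_mul ε).mul dr).mul
        ((i.const_mul u).div dw pw.ne')))
    refine (((d1.mul d2).mul d3).const_mul K).congr_deriv ?_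
    simp only [id, Pi.mul_apply, Pi.add_apply, Pi.neg_apply, Pi.div_apply, boxKernel, boxDiv,
      boxDivU, hK]
    rw [Real.rpow_sub_one pw.ne', Real.rpow_sub_one pr.ne']
    field_simp
    ring
  rw [integral_Ioi_of_hasDerivAt_of_tendsto' hderiv hint hlim]
  simp [hQ]

theorem abs_boxDivU_le {ε u w : ℝ} (hε : ε ∈ Ioo (-1 : ℝ) 0) (hu : 0 < u) (hw : 0 < w) :
    |boxDivU ε u w| ≤ 3 * (1 + w) := by
  obtain ⟨h1, h2⟩ := hε
  have hx : 0 < u * w := by positivity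
  rw [boxDivU, abs_neg, abs_div, abs_of_pos (show 0 < (1 + u * w) ^ 2 by positivity),
    div_le_iff₀ (by positivity)]
  have a6 : |ε| ≤ 1 := by rw [abs_le]; constructor <;> linarith
  have a7 : |1 - w| ≤ 1 + w := by rw [abs_le]; constructor <;> linarith
  calc |w * ε * (-ε + u * (1 - w) + ε * (u ^ 2 * w))|
      = |ε| * |w * (-ε) + u * w * (1 - w) + ε * (u * w) ^ 2| := by
        rw [← abs_mul]; congr 1; ring
    _ ≤ 1 * (w * |ε| + u * w * |1 - w| + |ε| * (u * w) ^ 2) := by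
        refine mul_le_mul a6 ((abs_add_three _ _ _).trans_eq ?_) (abs_nonneg _) zero_le_one
        rw [abs_mul, abs_mul (u * w), abs_mul ε, abs_neg, abs_of_pos hw, abs_of_pos hx,
          abs_of_pos (show 0 < (u * w) ^ 2 by positivity)]
    _ ≤ 1 * (w * 1 + u * w * (1 + w) + 1 * (u * w) ^ 2) := by gcongr
    _ ≤ 3 * (1 + w) * (1 + u * w) ^ 2 := by
        nlinarith [mul_pos hx hw, mul_pos (mul_pos hx hx) hw, mul_pos hx hx]

theorem integral_boxDiv {r ε : ℝ} (hr : 0 < r) (hε : ε ∈ Ioo (-1 : ℝ) 0)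
    (hint : Integrable (fun x : ℝ × ℝ => boxKernel r ε x.1 x.2 * boxDiv r ε x.2)
      ((volume.restrict (Ioi 0)).prod (volume.restrict (Ioi 0)))) :
    ∫ x, boxKernel r ε x.1 x.2 * boxDiv r ε x.2
      ∂((volume.restrict (Ioi 0)).prod (volume.restrict (Ioi 0))) = 0 := by
  have hU := integrable_boxKernel_mul hr hε (g := fun x => boxDivU ε x.1 x.2) (by
    unfold boxDivU
    refine ContinuousOn.neg (ContinuousOn.div (by fun_prop) (by fun_prop) ?_)
    rintro ⟨u, w⟩ ⟨hu, hw⟩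
    simp only [mem_Ioi] at hu hw
    positivity) 3 (fun u hu w hw => abs_boxDivU_le hε hu hw)
  have hsub : Integrable
      (fun x : ℝ × ℝ => boxKernel r ε x.1 x.2 * (boxDiv r ε x.2 - boxDivU ε x.1 x.2))
      ((volume.restrict (Ioi 0)).prod (volume.restrict (Ioi 0))) := by
    simp only [mul_sub]
    exact hint.sub hU
  have z1 : ∫ x, boxKernel r ε x.1 x.2 * boxDivU ε x.1 x.2
      ∂((volume.restrict (Ioi 0)).prod (volume.restrict (Ioi 0))) = 0 := by
    rw [integral_prod_symm _ hU]
    exact (setIntegral_congr_fun measurableSet_Ioi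
      fun w hw => integral_boxDivU hε hw).trans (by simp)
  have z2 : ∫ x, boxKernel r ε x.1 x.2 * (boxDiv r ε x.2 - boxDivU ε x.1 x.2)
      ∂((volume.restrict (Ioi 0)).prod (volume.restrict (Ioi 0))) = 0 := by
    rw [integral_prod _ hsub]
    exact (setIntegral_congr_fun measurableSet_Ioi
      fun u hu => integral_boxDiv_sub_boxDivU hr hε hu).trans (by simp)
  have h := integral_add hU hsub
  rw [z1, z2, add_zero] at h
  exact (integral_congr_ae (.of_forall fun x => by ring)).trans h

/-- Reduction identity for `I(3,2,3,2;2ε)` of the one-loop massless box: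
`(3+ε)(4+ε) r (1+r) I(3,2,3,2;2ε)
  = I(2,1,2,1;2ε) − I(1,2,1,2;2ε) + (3+ε)(1+ε+3r) I(2,2,2,2;2ε)`. -/
theorem box_reduction_3232 (r ε : ℝ) (hr : 0 < r) (hε : ε ∈ Set.Ioo (-1 : ℝ) 0) :
    IntegrableOn (fun z => z.1 ^ 2 * z.2.1 * z.2.2 ^ 2 * boxZ4 z * boxF r z ^ (-(5 + ε)))
      boxDelta volume ∧
    IntegrableOn (fun z => z.1 * z.2.2 * boxF r z ^ (-(3 + ε))) boxDelta volume ∧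
    IntegrableOn (fun z => z.2.1 * boxZ4 z * boxF r z ^ (-(3 + ε))) boxDelta volume ∧
    IntegrableOn (fun z => z.1 * z.2.1 * z.2.2 * boxZ4 z * boxF r z ^ (-(4 + ε))) boxDelta volume ∧
    (3 + ε) * (4 + ε) * r * (1 + r) *
        ∫ z in boxDelta, z.1 ^ 2 * z.2.1 * z.2.2 ^ 2 * boxZ4 z * boxF r z ^ (-(5 + ε)) =
      (∫ z in boxDelta, z.1 * z.2.2 * boxF r z ^ (-(3 + ε)))
        - (∫ z in boxDelta, z.2.1 * boxZ4 z * boxF r z ^ (-(3 + ε)))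
        + (3 + ε) * (1 + ε + 3 * r) *
            ∫ z in boxDelta, z.1 * z.2.1 * z.2.2 * boxZ4 z * boxF r z ^ (-(4 + ε)) := by
  have hmem : ∀ z ∈ boxDelta, 0 < z.1 ∧ 0 < z.2.1 ∧ 0 < z.2.2 ∧ 0 < boxZ4 z ∧ 0 < boxF r z := by
    rintro z ⟨h1, h2, h3, h4⟩
    have h5 : 0 < boxZ4 z := by unfold boxZ4; linarith
    exact ⟨h1, h2, h3, h5, by unfold boxF; positivity⟩
  have hw : ∀ z ∈ boxDelta, r + (boxParamInv z).2.2 = boxF r z / (z.1 * z.2.2) := by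
    intro z hz
    obtain ⟨h1, h2, h3, h5, h6⟩ := hmem z hz
    simp only [boxParamInv, boxF]
    field_simp
  have hF : ∀ x : ℝ, 0 < x → x ^ (-(4 + ε)) = x ^ (-(3 + ε)) / x := fun x hx => by
    rw [← Real.rpow_sub_one hx.ne']; congr 1; ring
  have hF' : ∀ x : ℝ, 0 < x → x ^ (-(5 + ε)) = x ^ (-(3 + ε)) / x / x := fun x hx => by
    rw [← hF x hx, ← Real.rpow_sub_one hx.ne']; congr 1; ring
  have hden : ∀ x ∈ (Ioi 0 ×ˢ Ioi 0 : Set (ℝ × ℝ)), r + x.2 ≠ 0 := fun x hx =>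
    (add_pos hr hx.2).ne'
  have g1 := integrable_boxKernel_mul hr hε (g := fun x => x.2 / (r + x.2) ^ 2)
    (ContinuousOn.div (by fun_prop) (by fun_prop) fun x hx => pow_ne_zero 2 (hden x hx)) (1 / r)
    (fun u _ w (hw : 0 < w) => by
      rw [abs_of_nonneg (by positivity), div_le_iff₀ (by positivity), div_mul_eq_mul_div, one_mul,
        div_mul_eq_mul_div, le_div_iff₀ hr]
      nlinarith [mul_pos hr hw, mul_pos hw hw, mul_pos hw (mul_pos hw hw),
        mul_pos hr (mul_pos hw hw), mul_pos (mul_pos hr hr) hw])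
  have g2 := integrable_boxKernel_mul hr hε (g := fun _ => 1) continuousOn_const 1
    (fun u _ w (hw : 0 < w) => by rw [abs_one]; linarith)
  have g3 := integrable_boxKernel_mul hr hε (g := fun x => x.2) continuousOn_snd 1
    (fun u _ w (hw : 0 < w) => by rw [abs_of_pos hw]; linarith)
  have g4 := integrable_boxKernel_mul hr hε (g := fun x => x.2 / (r + x.2))
    (ContinuousOn.div (by fun_prop) (by fun_prop) hden) 1
    (fun u _ w (hw : 0 < w) => by
      rw [abs_of_nonneg (by positivity), div_le_iff₀ (by positivity)]
      nlinarith [mul_pos hr hw, mul_pos hw hw])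
  obtain ⟨i1, j1⟩ := integral_boxDelta hr hε (g := fun w => w / (r + w) ^ 2)
    (f := fun z => z.1 ^ 2 * z.2.1 * z.2.2 ^ 2 * boxZ4 z * boxF r z ^ (-(5 + ε)))
    (fun z hz => by
      obtain ⟨h1, h2, h3, h5, h6⟩ := hmem z hz
      simp only [hw z hz, hF' _ h6]
      simp only [boxParamInv]
      field_simp) g1
  obtain ⟨i2, j2⟩ := integral_boxDelta hr hε (g := fun _ => 1)
    (f := fun z => z.1 * z.2.2 * boxF r z ^ (-(3 + ε))) (fun z _ => (mul_one _).symm) g2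
  obtain ⟨i3, j3⟩ := integral_boxDelta hr hε (g := fun w => w)
    (f := fun z => z.2.1 * boxZ4 z * boxF r z ^ (-(3 + ε)))
    (fun z hz => by
      obtain ⟨h1, h2, h3, h5, h6⟩ := hmem z hz
      simp only [boxParamInv]
      field_simp) g3
  obtain ⟨i4, j4⟩ := integral_boxDelta hr hε (g := fun w => w / (r + w))
    (f := fun z => z.1 * z.2.1 * z.2.2 * boxZ4 z * boxF r z ^ (-(4 + ε)))
    (fun z hz => by
      obtain ⟨h1, h2, h3, h5, h6⟩ := hmem z hz
      simp only [hw z hz, hF _ h6]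
      simp only [boxParamInv]
      field_simp) g4
  refine ⟨i1, i2, i3, i4, ?_⟩
  have g1' := g1.const_mul ((3 + ε) * (4 + ε) * r * (1 + r))
  have g4' := g4.const_mul ((3 + ε) * (1 + ε + 3 * r))
  have hsum : (fun x : ℝ × ℝ => boxKernel r ε x.1 x.2 * boxDiv r ε x.2) = fun x =>
      (3 + ε) * (4 + ε) * r * (1 + r) * (boxKernel r ε x.1 x.2 * (x.2 / (r + x.2) ^ 2)) -
        boxKernel r ε x.1 x.2 * 1 + boxKernel r ε x.1 x.2 * x.2 -
        (3 + ε) * (1 + ε + 3 * r) * (boxKernel r ε x.1 x.2 * (x.2 / (r + x.2))) := by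
    ext x
    unfold boxDiv
    ring
  have g12 : Integrable (fun x : ℝ × ℝ =>
      (3 + ε) * (4 + ε) * r * (1 + r) * (boxKernel r ε x.1 x.2 * (x.2 / (r + x.2) ^ 2)) -
        boxKernel r ε x.1 x.2 * 1)
      ((volume.restrict (Ioi 0)).prod (volume.restrict (Ioi 0))) := g1'.sub g2
  have g123 : Integrable (fun x : ℝ × ℝ =>
      (3 + ε) * (4 + ε) * r * (1 + r) * (boxKernel r ε x.1 x.2 * (x.2 / (r + x.2) ^ 2)) -
        boxKernel r ε x.1 x.2 * 1 + boxKernel r ε x.1 x.2 * x.2)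
      ((volume.restrict (Ioi 0)).prod (volume.restrict (Ioi 0))) := g12.add g3
  have hz := integral_boxDiv hr hε (by rw [hsum]; exact g123.sub g4')
  rw [hsum, integral_sub g123 g4', integral_add g12 g3,
    integral_sub g1' g2, integral_const_mul, integral_const_mul] at hz
  rw [j1, j2, j3, j4]
  linear_combination (∫ b in Ioi (0 : ℝ), b ^ (-1 - ε) * (1 + b) ^ (2 * ε)) * hz
end
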